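/- Let a₁, a₂ ≥ 1 be integers such that n = a₁ + a₂ is even (so n ≥ 2). Then there exist positive rational numbers ρ₀, ρ₂, …, ρ_{n−4} (indexed by the even integers 2i with 0 ≤ 2i ≤ n−4) and a nonnegative rational number ρ_{n−2} such that ∫_0^∞ ℓ · V_{a₁}(ℓ) · V_{a₂}(ℓ) dℓ = ∑_{i=0}^{(n−4)/2} ρ_{2i} · π^{2i} · ζ(n−1−2i) + ρ_{n−2} · π^{n−2} · log 2, where ζ(m) denotes ∑_{k=1}^{∞} 1/k^m; moreover ρ_{n−2} > 0 if and only if both a₁ and a₂ are odd. -/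

import Mathlib

open MeasureTheory Real

/-- The Mirzakhani volume `V_{𝔸ₙ}(ℓ)` of the moduli space of hyperbolic `n`-crowns with
neck length `ℓ`. -/
noncomputable def crownVol (n : ℕ) (d : ℝ) : ℝ :=
  if n % 2 = 0 then
    d / Real.sinh (d / 2) *
      (∏ j ∈ Finset.Icc 1 (n / 2 - 1), (d ^ 2 + (2 * (j : ℝ)) ^ 2 * Real.pi ^ 2)) /
      (2 * (Nat.factorial (n - 1) : ℝ))
  else
    1 / Real.cosh (d / 2) *
      (∏ j ∈ Finset.Icc 1 (n / 2), (d ^ 2 + (2 * (j : ℝ) - 1) ^ 2 * Real.pi ^ 2)) /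
      (2 * (Nat.factorial (n - 1) : ℝ))

/-- Multiplying a polynomial in `x ^ 2` and `π ^ 2`, homogeneous with positive rational
coefficients, by factors `x ^ 2 + q i * π ^ 2` with `q i > 0` gives another such polynomial. -/
theorem exists_pos_coeff_prod {ι : Type*} (s : Finset ι) (q : ι → ℚ) (hq : ∀ i ∈ s, 0 < q i)
    (N : ℕ) (f : ℝ → ℝ)
    (hf : ∃ c : ℕ → ℚ, (∀ j ≤ N, 0 < c j) ∧
      ∀ x, f x = ∑ j ∈ Finset.range (N + 1), (c j : ℝ) * π ^ (2 * (N - j)) * x ^ (2 * j)) :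
    ∃ c : ℕ → ℚ, (∀ j ≤ N + s.card, 0 < c j) ∧
      ∀ x, f x * ∏ i ∈ s, (x ^ 2 + (q i : ℝ) * π ^ 2) =
        ∑ j ∈ Finset.range (N + s.card + 1),
          (c j : ℝ) * π ^ (2 * (N + s.card - j)) * x ^ (2 * j) := by
  classical
  induction s using Finset.induction_on with
  | empty => simpa using hf
  | insert a s ha ih =>
    obtain ⟨c, hc, h⟩ := ih fun i hi => hq i (Finset.mem_insert_of_mem hi)
    have hqa := hq a (Finset.mem_insert_self a s)
    rw [Finset.card_insert_of_notMem ha]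
    set M := N + s.card with hM
    rw [← add_assoc, ← hM]
    refine ⟨fun j => (if j = 0 then 0 else c (j - 1)) + (if j ≤ M then q a * c j else 0), ?_, ?_⟩
    · intro j hj
      rcases Nat.eq_zero_or_pos j with rfl | hj0
      · simpa using mul_pos hqa (hc 0 (Nat.zero_le _))
      · have h1 := hc (j - 1) (by omega)
        simp only [hj0.ne', if_false]
        split_ifs with h2
        · exact add_pos h1 (mul_pos hqa (hc j h2))
        · simpa using h1
    · intro x
      rw [Finset.prod_insert ha, mul_left_comm, h, add_mul]
      simp only [Rat.cast_add, add_mul, Finset.sum_add_distrib]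
      congr 1
      · rw [Finset.mul_sum, Finset.sum_range_succ' _ (M + 1)]
        simp only [Nat.succ_ne_zero, if_false, Nat.add_sub_cancel, if_true, Rat.cast_zero, zero_mul,
          add_zero, Nat.add_sub_add_right]
        exact Finset.sum_congr rfl fun j _ => by ring
      · rw [Finset.mul_sum, Finset.sum_range_succ _ (M + 1)]
        simp only [Nat.not_succ_le_self, if_false, Rat.cast_zero, zero_mul, add_zero]
        refine Finset.sum_congr rfl fun j hj => ?_
        have hj' : j ≤ M := by simpa [Nat.lt_succ_iff] using hj
        rw [if_pos hj', show 2 * (M + 1 - j) = 2 * (M - j) + 2 by omega]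
        push_cast
        ring

theorem integral_pow_mul_exp_neg_mul (m : ℕ) {r : ℝ} (hr : 0 < r) :
    ∫ x in Set.Ioi (0 : ℝ), x ^ m * exp (-(r * x)) = (m.factorial : ℝ) / r ^ (m + 1) := by
  have h := Real.integral_rpow_mul_exp_neg_mul_Ioi (a := m + 1) (by positivity) hr
  rw [Real.Gamma_nat_eq_factorial, add_sub_cancel_right] at h
  simp only [← Nat.cast_add_one, Real.rpow_natCast] at h
  rw [h, one_div, inv_pow, mul_comm, div_eq_mul_inv]

theorem sinh_half_sq (x : ℝ) : sinh (x / 2) ^ 2 = (1 - exp (-x)) ^ 2 / (4 * exp (-x)) := by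
  rw [Real.sinh_eq, show exp (-x) = exp (-(x / 2)) ^ 2 by
    rw [← exp_nat_mul]; congr 1; push_cast; ring]
  have h : exp (x / 2) = (exp (-(x / 2)))⁻¹ := by rw [exp_neg, inv_inv]
  rw [h]
  field_simp
  ring

theorem cosh_half_sq (x : ℝ) : cosh (x / 2) ^ 2 = (1 + exp (-x)) ^ 2 / (4 * exp (-x)) := by
  rw [Real.cosh_eq, show exp (-x) = exp (-(x / 2)) ^ 2 by
    rw [← exp_nat_mul]; congr 1; push_cast; ring]
  have h : exp (x / 2) = (exp (-(x / 2)))⁻¹ := by rw [exp_neg, inv_inv]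
  rw [h]
  field_simp
  ring

theorem summable_one_div_succ_pow {m : ℕ} (hm : 2 ≤ m) :
    Summable fun k : ℕ => 1 / ((k : ℝ) + 1) ^ m := by
  have := (summable_nat_add_iff 1).2 (Real.summable_one_div_nat_pow.2 hm)
  simpa using this

theorem tsum_one_div_succ_pow_pos {m : ℕ} (hm : 2 ≤ m) :
    0 < ∑' k : ℕ, 1 / ((k : ℝ) + 1) ^ m :=
  (summable_one_div_succ_pow hm).tsum_pos (fun k => by positivity) 0 (by simp)

theorem integral_pow_div_sinh_half_sq {m : ℕ} (hm : 2 ≤ m) :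
    ∫ x in Set.Ioi (0 : ℝ), x ^ m / sinh (x / 2) ^ 2 =
      4 * m.factorial * ∑' k : ℕ, 1 / ((k : ℝ) + 1) ^ m := by
  have hF (k : ℕ) : ∫ x in Set.Ioi (0 : ℝ), 4 * ((k : ℝ) + 1) * (x ^ m * exp (-((k + 1) * x))) =
      4 * m.factorial * (1 / ((k : ℝ) + 1) ^ m) := by
    rw [integral_const_mul, integral_pow_mul_exp_neg_mul m (by positivity)]
    field_simp
    ring
  have hInt (k : ℕ) : IntegrableOn (fun x : ℝ => 4 * ((k : ℝ) + 1) * (x ^ m * exp (-((k + 1) * x))))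
      (Set.Ioi 0) := by
    apply Integrable.of_integral_ne_zero
    rw [hF]
    positivity
  have hnorm (k : ℕ) : ∫ x in Set.Ioi (0 : ℝ), ‖4 * ((k : ℝ) + 1) * (x ^ m * exp (-((k + 1) * x)))‖ =
      4 * m.factorial * (1 / ((k : ℝ) + 1) ^ m) := by
    rw [← hF]
    refine setIntegral_congr_fun measurableSet_Ioi fun x (hx : 0 < x) => ?_
    exact Real.norm_of_nonneg (by positivity)
  have key := hasSum_integral_of_summable_integral_norm hInt
    (by simpa only [hnorm] using (summable_one_div_succ_pow hm).mul_left _)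
  simp only [hF] at key
  rw [← tsum_mul_left, key.tsum_eq]
  refine setIntegral_congr_fun measurableSet_Ioi fun x (hx : 0 < x) => ?_
  have hu : exp (-x) < 1 := by simpa using hx
  have hg := (hasSum_nat_add_iff' 1).2 (hasSum_coe_mul_geometric_of_norm_lt_one (r := exp (-x))
    (by rwa [Real.norm_of_nonneg (exp_pos _).le]))
  have h2 := hg.mul_left (4 * x ^ m)
  simp only [Finset.range_one, Finset.sum_singleton, Nat.cast_zero, zero_mul, sub_zero] at h2
  have h3 : ∀ k : ℕ, 4 * ((k : ℝ) + 1) * (x ^ m * exp (-((k + 1) * x))) =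
      4 * x ^ m * (((k + 1 : ℕ) : ℝ) * exp (-x) ^ (k + 1)) := fun k => by
    rw [← exp_nat_mul]
    push_cast
    rw [mul_neg]
    ring
  simp only [h3]
  rw [h2.tsum_eq, sinh_half_sq]
  have : 1 - exp (-x) ≠ 0 := by linarith
  field_simp

theorem integrableOn_pow_div_sinh_half_sq {m : ℕ} (hm : 2 ≤ m) :
    IntegrableOn (fun x : ℝ => x ^ m / sinh (x / 2) ^ 2) (Set.Ioi 0) := by
  apply Integrable.of_integral_ne_zero
  rw [integral_pow_div_sinh_half_sq hm]
  have := tsum_one_div_succ_pow_pos hm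
  positivity

theorem integral_pow_div_cosh_half_sq {m : ℕ} (hm : 2 ≤ m) :
    ∫ x in Set.Ioi (0 : ℝ), x ^ m / cosh (x / 2) ^ 2 =
      4 * m.factorial * (1 - 2 / 2 ^ m) * ∑' k : ℕ, 1 / ((k : ℝ) + 1) ^ m := by
  have hI := integrableOn_pow_div_sinh_half_sq hm
  have hI2 := ((integrableOn_Ioi_comp_mul_left_iff (fun x : ℝ => x ^ m / sinh (x / 2) ^ 2) 0
    (a := 2) two_pos).2 (by simpa using hI)).const_mul (4 / 2 ^ m)
  have e := integral_comp_mul_left_Ioi (fun x : ℝ => x ^ m / sinh (x / 2) ^ 2) 0 (b := 2) two_pos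
  have h : ∫ x in Set.Ioi (0 : ℝ), x ^ m / cosh (x / 2) ^ 2 =
      ∫ x in Set.Ioi (0 : ℝ), (x ^ m / sinh (x / 2) ^ 2 -
        4 / 2 ^ m * ((2 * x) ^ m / sinh (2 * x / 2) ^ 2)) := by
    refine setIntegral_congr_fun measurableSet_Ioi fun x (hx : 0 < x) => ?_
    have h1 : sinh (2 * x / 2) = 2 * sinh (x / 2) * cosh (x / 2) := by
      rw [← sinh_two_mul]; congr 1; ring
    have h2 : sinh (x / 2) ≠ 0 := (sinh_pos_iff.2 (by linarith)).ne'
    have h3 := (cosh_pos (x / 2)).ne'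
    simp only [h1]
    rw [mul_pow]
    field_simp
    linear_combination (-4 : ℝ) * cosh_sq (x / 2)
  rw [h, integral_sub hI hI2, integral_const_mul, e, mul_zero, integral_pow_div_sinh_half_sq hm,
    smul_eq_mul]
  ring

theorem integrableOn_pow_div_cosh_half_sq {m : ℕ} (hm : 2 ≤ m) :
    IntegrableOn (fun x : ℝ => x ^ m / cosh (x / 2) ^ 2) (Set.Ioi 0) := by
  apply Integrable.of_integral_ne_zero
  rw [integral_pow_div_cosh_half_sq hm]
  have := tsum_one_div_succ_pow_pos hm
  have h2 : (2 : ℝ) / 2 ^ m < 1 := by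
    rw [div_lt_one (by positivity)]
    exact lt_self_pow₀ one_lt_two hm
  have h3 : (0 : ℝ) < 1 - 2 / 2 ^ m := by linarith
  positivity

theorem integral_div_cosh_half_sq :
    ∫ x in Set.Ioi (0 : ℝ), x / cosh (x / 2) ^ 2 = 4 * log 2 := by
  have hderiv : ∀ x ∈ Set.Ici (0 : ℝ), HasDerivAt
      (fun x => -4 * (x * exp (-x)) / (1 + exp (-x)) - 4 * log (1 + exp (-x)))
      (x / cosh (x / 2) ^ 2) x := fun x _ => by
    have hu : HasDerivAt (fun x : ℝ => exp (-x)) (-exp (-x)) x := by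
      simpa using (hasDerivAt_neg x).exp
    have hp : 1 + exp (-x) ≠ 0 := by positivity
    have := ((((hasDerivAt_id x).mul hu).const_mul (-4)).div (hu.const_add 1) hp).sub
      (((hu.const_add 1).log hp).const_mul 4)
    refine this.congr_deriv ?_
    rw [cosh_half_sq]
    simp only [id, Pi.mul_apply]
    field_simp
    ring
  have hlim : Filter.Tendsto
      (fun x : ℝ => -4 * (x * exp (-x)) / (1 + exp (-x)) - 4 * log (1 + exp (-x)))
      Filter.atTop (nhds 0) := by
    have h1 : Filter.Tendsto (fun x : ℝ => x * exp (-x)) Filter.atTop (nhds 0) := by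
      simpa using Real.tendsto_pow_mul_exp_neg_atTop_nhds_zero 1
    have h2 : Filter.Tendsto (fun x : ℝ => 1 + exp (-x)) Filter.atTop (nhds 1) := by
      simpa using Real.tendsto_exp_neg_atTop_nhds_zero.const_add 1
    have := ((h1.const_mul (-4)).div h2 one_ne_zero).sub ((h2.log one_ne_zero).const_mul 4)
    simpa using this
  rw [integral_Ioi_of_hasDerivAt_of_nonneg' hderiv (fun x (hx : 0 < x) => by positivity) hlim]
  norm_num

theorem integrableOn_div_cosh_half_sq :
    IntegrableOn (fun x : ℝ => x / cosh (x / 2) ^ 2) (Set.Ioi 0) := by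
  apply Integrable.of_integral_ne_zero
  rw [integral_div_cosh_half_sq]
  have := log_pos one_lt_two
  positivity

theorem integral_sum_range_mul_pow (N r : ℕ) (a I : ℕ → ℝ) (w : ℝ → ℝ)
    (hw : ∀ j ≤ N, IntegrableOn (fun x => x ^ (2 * j + r) / w x) (Set.Ioi 0))
    (hI : ∀ j ≤ N, ∫ x in Set.Ioi (0 : ℝ), x ^ (2 * j + r) / w x = I j) :
    ∫ x in Set.Ioi (0 : ℝ), x ^ r / w x * ∑ j ∈ Finset.range (N + 1), a j * x ^ (2 * j) =
      ∑ j ∈ Finset.range (N + 1), a (N - j) * I (N - j) := by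
  have h (x : ℝ) : x ^ r / w x * ∑ j ∈ Finset.range (N + 1), a j * x ^ (2 * j) =
      ∑ j ∈ Finset.range (N + 1), a j * (x ^ (2 * j + r) / w x) := by
    rw [Finset.mul_sum]
    exact Finset.sum_congr rfl fun j _ => by ring
  simp only [h]
  rw [integral_finsetSum _ fun j hj =>
    (hw j (Nat.lt_succ_iff.1 (Finset.mem_range.1 hj))).const_mul (a j)]
  rw [← Finset.sum_range_reflect]
  refine Finset.sum_congr rfl fun j hj => ?_
  rw [Nat.succ_sub_one, integral_const_mul, hI _ (Nat.sub_le _ _)]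

theorem exists_pos_coeff_mul_prod_mul_prod (K : ℚ) (hK : 0 < K) (q : ℕ → ℚ)
    (hq : ∀ j, 1 ≤ j → 0 < q j) (k l : ℕ) :
    ∃ c : ℕ → ℚ, (∀ j ≤ k + l, 0 < c j) ∧
      ∀ x : ℝ, (K : ℝ) * (∏ j ∈ Finset.Icc 1 k, (x ^ 2 + (q j : ℝ) * π ^ 2)) *
          (∏ j ∈ Finset.Icc 1 l, (x ^ 2 + (q j : ℝ) * π ^ 2)) =
        ∑ j ∈ Finset.range (k + l + 1),
          (c j : ℝ) * π ^ (2 * (k + l - j)) * x ^ (2 * j) := by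
  have h1 := exists_pos_coeff_prod (Finset.Icc 1 k) q (fun j hj => hq j (Finset.mem_Icc.1 hj).1)
    0 (fun _ => (K : ℝ)) ⟨fun _ => K, fun _ _ => hK, fun x => by simp⟩
  have h2 := exists_pos_coeff_prod (Finset.Icc 1 l) q (fun j hj => hq j (Finset.mem_Icc.1 hj).1)
    _ _ h1
  simpa using h2

theorem crownVol_two_mul_add_two (k : ℕ) (x : ℝ) :
    crownVol (2 * k + 2) x = x / sinh (x / 2) *
      (∏ j ∈ Finset.Icc 1 k, (x ^ 2 + (((2 * j) ^ 2 : ℚ) : ℝ) * π ^ 2)) /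
      (2 * ((2 * k + 1).factorial : ℝ)) := by
  rw [crownVol, if_pos (by omega), show (2 * k + 2) / 2 - 1 = k by omega]
  push_cast
  rfl

theorem crownVol_two_mul_add_one (k : ℕ) (x : ℝ) :
    crownVol (2 * k + 1) x = 1 / cosh (x / 2) *
      (∏ j ∈ Finset.Icc 1 k, (x ^ 2 + (((2 * j - 1) ^ 2 : ℚ) : ℝ) * π ^ 2)) /
      (2 * ((2 * k).factorial : ℝ)) := by
  rw [crownVol, if_neg (by omega), show (2 * k + 1) / 2 = k by omega]
  push_cast
  rfl

theorem exists_integral_crownVol_even_even (k l : ℕ) :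
    ∃ ρ : ℕ → ℚ, (∀ i ∈ Finset.range (k + l + 1), 0 < ρ i) ∧
      ∫ x in Set.Ioi (0 : ℝ), x * crownVol (2 * k + 2) x * crownVol (2 * l + 2) x =
        ∑ i ∈ Finset.range (k + l + 1), (ρ i : ℝ) * π ^ (2 * i) *
          ∑' m : ℕ, 1 / ((m : ℝ) + 1) ^ (2 * (k + l - i) + 3) := by
  obtain ⟨c, hc, h⟩ := exists_pos_coeff_mul_prod_mul_prod
    (1 / (4 * (2 * k + 1).factorial * (2 * l + 1).factorial)) (by positivity)
    (fun j => (2 * j) ^ 2) (fun j hj => by positivity) k l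
  refine ⟨fun i => c (k + l - i) * (4 * (2 * (k + l - i) + 3).factorial), fun i _ => ?_, ?_⟩
  · exact mul_pos (hc _ (Nat.sub_le _ _)) (by positivity)
  have h3 (x : ℝ) : x * crownVol (2 * k + 2) x * crownVol (2 * l + 2) x =
      x ^ 3 / sinh (x / 2) ^ 2 * ∑ j ∈ Finset.range (k + l + 1),
          (c j : ℝ) * π ^ (2 * (k + l - j)) * x ^ (2 * j) := by
    rw [← h, crownVol_two_mul_add_two, crownVol_two_mul_add_two]
    push_cast
    ring
  simp only [h3]
  rw [integral_sum_range_mul_pow (k + l) 3 (fun j => (c j : ℝ) * π ^ (2 * (k + l - j))) _ _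
    (fun j _ => integrableOn_pow_div_sinh_half_sq (by omega))
    (fun j _ => integral_pow_div_sinh_half_sq (by omega))]
  refine Finset.sum_congr rfl fun i hi => ?_
  rw [Nat.sub_sub_self (Nat.lt_succ_iff.1 (Finset.mem_range.1 hi))]
  push_cast
  ring

theorem exists_integral_crownVol_odd_odd (k l : ℕ) :
    ∃ (ρ : ℕ → ℚ) (ρlast : ℚ), (∀ i ∈ Finset.range (k + l), 0 < ρ i) ∧ 0 < ρlast ∧
      ∫ x in Set.Ioi (0 : ℝ), x * crownVol (2 * k + 1) x * crownVol (2 * l + 1) x =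
        (∑ i ∈ Finset.range (k + l), (ρ i : ℝ) * π ^ (2 * i) *
          ∑' m : ℕ, 1 / ((m : ℝ) + 1) ^ (2 * (k + l - i) + 1)) +
        (ρlast : ℝ) * π ^ (2 * (k + l)) * log 2 := by
  obtain ⟨c, hc, h⟩ := exists_pos_coeff_mul_prod_mul_prod
    (1 / (4 * (2 * k).factorial * (2 * l).factorial)) (by positivity)
    (fun j => (2 * j - 1) ^ 2) (fun j hj => by
      have : (1 : ℚ) ≤ j := by exact_mod_cast hj
      exact pow_pos (by linarith) 2) k l
  refine ⟨fun i => c (k + l - i) * (4 * (2 * (k + l - i) + 1).factorial *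
    (1 - 2 / 2 ^ (2 * (k + l - i) + 1))), c 0 * 4, fun i hi => ?_,
    mul_pos (hc 0 (Nat.zero_le _)) (by norm_num), ?_⟩
  · have hi' := Finset.mem_range.1 hi
    have h2 : (2 : ℚ) / 2 ^ (2 * (k + l - i) + 1) < 1 := by
      rw [div_lt_one (by positivity)]
      exact lt_self_pow₀ one_lt_two (by omega)
    have h3 : (0 : ℚ) < 1 - 2 / 2 ^ (2 * (k + l - i) + 1) := by linarith
    exact mul_pos (hc _ (Nat.sub_le _ _)) (by positivity)
  have h3 (x : ℝ) : x * crownVol (2 * k + 1) x * crownVol (2 * l + 1) x =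
      x ^ 1 / cosh (x / 2) ^ 2 * ∑ j ∈ Finset.range (k + l + 1),
          (c j : ℝ) * π ^ (2 * (k + l - j)) * x ^ (2 * j) := by
    rw [← h, crownVol_two_mul_add_one, crownVol_two_mul_add_one]
    push_cast
    ring
  simp only [h3]
  rw [integral_sum_range_mul_pow (k + l) 1 (fun j => (c j : ℝ) * π ^ (2 * (k + l - j)))
    (fun j => if j = 0 then 4 * log 2 else 4 * (2 * j + 1).factorial * (1 - 2 / 2 ^ (2 * j + 1)) *
      ∑' m : ℕ, 1 / ((m : ℝ) + 1) ^ (2 * j + 1)) _ ?_ ?_, Finset.sum_range_succ]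
  · congr 1
    · refine Finset.sum_congr rfl fun i hi => ?_
      have hi' := Finset.mem_range.1 hi
      rw [Nat.sub_sub_self hi'.le, if_neg (by omega)]
      push_cast
      ring
    · simp only [Nat.sub_self, if_true, Nat.sub_zero]
      push_cast
      ring
  · intro j _
    rcases Nat.eq_zero_or_pos j with rfl | hj
    · simpa using integrableOn_div_cosh_half_sq
    · exact integrableOn_pow_div_cosh_half_sq (by omega)
  · intro j _
    rcases Nat.eq_zero_or_pos j with rfl | hj
    · simpa using integral_div_cosh_half_sq
    · rw [if_neg hj.ne', integral_pow_div_cosh_half_sq (by omega)]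

/-- For `n = a₁ + a₂` even, the Mirzakhani volume of the moduli space of
`(a₁,a₂)`-annuli equals `∑ᵢ ρ_{2i} π^{2i} ζ(n-1-2i) + ρ_{n-2} π^{n-2} log 2`
with `ρ_{2i} ∈ ℚ_{>0}` for `0 ≤ 2i ≤ n-4` and `ρ_{n-2} ∈ ℚ_{≥0}`, where
`ρ_{n-2} > 0` iff both `a₁` and `a₂` are odd. -/
theorem annuli_volume_even (a₁ a₂ : ℕ) (h₁ : 1 ≤ a₁) (h₂ : 1 ≤ a₂)
    (heven : Even (a₁ + a₂)) :
    ∃ (ρ : ℕ → ℚ) (ρlast : ℚ),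
      (∀ i ∈ Finset.range ((a₁ + a₂) / 2 - 1), 0 < ρ i) ∧
      0 ≤ ρlast ∧
      (∫ ℓ in Set.Ioi (0 : ℝ), ℓ * crownVol a₁ ℓ * crownVol a₂ ℓ)
        = (∑ i ∈ Finset.range ((a₁ + a₂) / 2 - 1),
            (ρ i : ℝ) * Real.pi ^ (2 * i) *
              ∑' k : ℕ, 1 / ((k : ℝ) + 1) ^ (a₁ + a₂ - 1 - 2 * i))
          + (ρlast : ℝ) * Real.pi ^ (a₁ + a₂ - 2) * Real.log 2 ∧
      (0 < ρlast ↔ Odd a₁ ∧ Odd a₂) := by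
  rcases Nat.even_or_odd' a₁ with ⟨k, rfl | rfl⟩ <;> rcases Nat.even_or_odd' a₂ with ⟨l, rfl | rfl⟩
  · obtain ⟨k, rfl⟩ := Nat.exists_eq_add_of_le' (show 1 ≤ k by omega)
    obtain ⟨l, rfl⟩ := Nat.exists_eq_add_of_le' (show 1 ≤ l by omega)
    obtain ⟨ρ, hρ, h⟩ := exists_integral_crownVol_even_even k l
    have hN : (2 * (k + 1) + 2 * (l + 1)) / 2 - 1 = k + l + 1 := by omega
    rw [hN]
    refine ⟨ρ, 0, hρ, le_rfl, ?_, by simp⟩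
    rw [mul_add_one, mul_add_one, h, Rat.cast_zero, zero_mul, zero_mul, add_zero]
    refine Finset.sum_congr rfl fun i hi => ?_
    have hi' := Finset.mem_range.1 hi
    rw [show 2 * k + 2 + (2 * l + 2) - 1 - 2 * i = 2 * (k + l - i) + 3 by omega]
  · exact absurd heven (by simp [parity_simps])
  · exact absurd heven (by simp [parity_simps])
  · obtain ⟨ρ, ρlast, hρ, hlast, h⟩ := exists_integral_crownVol_odd_odd k l
    have hN : (2 * k + 1 + (2 * l + 1)) / 2 - 1 = k + l := by omega
    rw [hN]
    refine ⟨ρ, ρlast, hρ, hlast.le, ?_, by simp [hlast]⟩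
    rw [h, show 2 * k + 1 + (2 * l + 1) - 2 = 2 * (k + l) by omega]
    congr 1
    refine Finset.sum_congr rfl fun i hi => ?_
    have hi' := Finset.mem_range.1 hi
    rw [show 2 * k + 1 + (2 * l + 1) - 1 - 2 * i = 2 * (k + l - i) + 1 by omega]
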